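/- arXiv:2312.09643 — 2 statements merged into one kernel-verified Lean document; each statement's English description precedes it below -/
import Mathlib

section
/- In the setting of the generalized UIRS protocol with independent sequences (finite group G, matrix representations ω : G → M_D(ℂ), τ1 : G → M_{d1}(ℂ), τ2 : G → M_{d2}(ℂ), matrices Λ_L, Λ_R ∈ M_D(ℂ) with Λ = Λ_R·Λ_L, finite outcome set X with row vectors ℓ_x ∈ ℂ^D, column vector ρ ∈ ℂ^D, matrices B_{xy}, A ∈ M_{d1·d2}(ℂ), and with p(x,g⃗), f_A, k_A(m), P, Θ, Φ defined exactly as in Theorem 1), assume in addition that P ≠ 0 and that for every M ∈ M_{d1·d2·D²}(ℂ) there exists a scalar c(M) ∈ ℂ with P·M·P = c(M)·P (as holds when τ1 and τ2 are irreducible and ω contains exactly one copy of each). Then Tr(P) ≠ 0 and, setting p = Tr(P·(A⊗Λ⊗Λ)·P)/Tr(P), one has k_A(m) = Tr(Θ)·p^{m−1} for every m ≥ 1; that is, the correlator decays as a single exponential in the sequence length m. -/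
open Matrix Kronecker BigOperators

theorem aux_ofFn_succ {M : Type*} [Monoid M] (m : ℕ) (f : Fin (m + 1) → M) :
    (List.ofFn f).reverse.prod =
      f (Fin.last m) * (List.ofFn fun i : Fin m => f i.castSucc).reverse.prod := by
  rw [List.ofFn_succ']
  simp

theorem aux_kron {n k : Type*} [Fintype n] [Fintype k] [DecidableEq n] [DecidableEq k] :
    ∀ (m : ℕ) (a : Fin m → Matrix n n ℂ) (b : Fin m → Matrix k k ℂ),
    (List.ofFn fun i => a i ⊗ₖ b i).reverse.prod =
      (List.ofFn a).reverse.prod ⊗ₖ (List.ofFn b).reverse.prod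
  | 0, a, b => by simp
  | m + 1, a, b => by
    rw [aux_ofFn_succ, aux_ofFn_succ, aux_ofFn_succ, aux_kron m, ← Matrix.mul_kronecker_mul]

theorem aux_sum_succ {G : Type*} [Fintype G] {M : Type*} [AddCommMonoid M] (m : ℕ)
    (H : (Fin (m + 1) → G) → M) :
    ∑ g, H g = ∑ a : G, ∑ g : Fin m → G, H (Fin.snoc (α := fun _ => G) g a) := by
  rw [← (Fin.snocEquiv (fun _ : Fin (m + 1) => G)).sum_comp, Fintype.sum_prod_type]
  rfl

theorem aux_sum_succ2 {G : Type*} [Fintype G] {M : Type*} [Ring M] (m : ℕ)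
    (F : G → G → M) (Q : (Fin m → G) → (Fin m → G) → M) :
    ∑ g : Fin (m + 1) → G, ∑ h : Fin (m + 1) → G, F (g (Fin.last m)) (h (Fin.last m)) *
        Q (fun i => g i.castSucc) (fun i => h i.castSucc) =
      (∑ a, ∑ b, F a b) * ∑ g, ∑ h, Q g h := by
  rw [aux_sum_succ]
  simp_rw [aux_sum_succ m (fun h : Fin (m + 1) → G => _ * _)]
  simp only [Fin.snoc_last, Fin.snoc_castSucc]
  simp_rw [Finset.sum_mul, Finset.mul_sum]
  refine Finset.sum_congr rfl fun a _ => ?_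
  rw [Finset.sum_comm]

theorem aux_sum_pow {G : Type*} [Fintype G] {M : Type*} [Ring M] (F : G → G → M) :
    ∀ m : ℕ, ∑ g : Fin m → G, ∑ h : Fin m → G,
      (List.ofFn fun i => F (g i) (h i)).reverse.prod = (∑ a, ∑ b, F a b) ^ m
  | 0 => by simp
  | m + 1 => by
    simp_rw [aux_ofFn_succ]
    rw [aux_sum_succ2 m F (fun g h => (List.ofFn fun i => F (g i) (h i)).reverse.prod),
      aux_sum_pow F m, pow_succ']

theorem aux_shift {D : ℕ} (L R : Matrix (Fin D) (Fin D) ℂ) :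
    ∀ (m : ℕ) (w : Fin (m + 1) → Matrix (Fin D) (Fin D) ℂ),
    (List.ofFn fun i => L * w i * R).reverse.prod =
      L * (w (Fin.last m) * (List.ofFn fun i : Fin m => (R * L) * w i.castSucc).reverse.prod) * R
  | 0, w => by simp
  | m + 1, w => by
    rw [aux_ofFn_succ, aux_shift L R m, aux_ofFn_succ]
    simp only [Matrix.mul_assoc]

theorem aux_tr {D : ℕ} (L R M : Matrix (Fin D) (Fin D) ℂ) (l r : Fin D → ℂ) :
    l ⬝ᵥ (L * M * R).mulVec r = trace (vecMulVec (R.mulVec r) (l ᵥ* L) * M) := by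
  rw [Matrix.vecMulVec_mul, Matrix.trace_vecMulVec, dotProduct_comm (R *ᵥ r),
    ← Matrix.dotProduct_mulVec, ← Matrix.dotProduct_mulVec, Matrix.mulVec_mulVec,
    Matrix.mulVec_mulVec, Matrix.mul_assoc]

/-- Single-copy special case of Theorem 1 of the paper: if the group-averaged projector `P`
is nonzero and compresses every matrix to a scalar multiple of itself
(`P·M·P = c(M)·P`), then `Tr P ≠ 0` and the independent-sequence correlator decays as a
single exponential, `k_A(m) = Tr(Θ) · p^{m-1}` with
`p = Tr(P·(A⊗Λ⊗Λ)·P)/Tr(P)`.  Sequence length `m ≥ 1` is represented as `m + 1`. -/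
theorem statement1
    (G : Type) [Fintype G] [Group G]
    (D d1 d2 : ℕ) (hD : 0 < D) (hd1 : 0 < d1) (hd2 : 0 < d2)
    (ω : G → Matrix (Fin D) (Fin D) ℂ)
    (τ1 : G → Matrix (Fin d1) (Fin d1) ℂ)
    (τ2 : G → Matrix (Fin d2) (Fin d2) ℂ)
    (hω1 : ω 1 = 1) (hω : ∀ g h : G, ω (g * h) = ω g * ω h)
    (hτ11 : τ1 1 = 1) (hτ1 : ∀ g h : G, τ1 (g * h) = τ1 g * τ1 h)
    (hτ21 : τ2 1 = 1) (hτ2 : ∀ g h : G, τ2 (g * h) = τ2 g * τ2 h)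
    (ΛL ΛR Λ : Matrix (Fin D) (Fin D) ℂ) (hΛ : Λ = ΛR * ΛL)
    (X : Type) [Fintype X]
    (ℓ : X → Fin D → ℂ) (ρ : Fin D → ℂ)
    (B : X → X → Matrix (Fin d1 × Fin d2) (Fin d1 × Fin d2) ℂ)
    (A : Matrix (Fin d1 × Fin d2) (Fin d1 × Fin d2) ℂ)
    -- the outcome probability p(x, g⃗) = ℓ_x (Λ_L ω(g_m) Λ_R) ⋯ (Λ_L ω(g_1) Λ_R) ρ
    (p : X → (m : ℕ) → (Fin m → G) → ℂ)
    (hp : ∀ (x : X) (m : ℕ) (g : Fin m → G),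
      p x m g = ℓ x ⬝ᵥ ((List.ofFn fun i : Fin m => ΛL * ω (g i) * ΛR).reverse.prod).mulVec ρ)
    -- the second-order sequence correlation function f_A(x, y, g⃗¹, g⃗²)
    (fA : X → X → (m : ℕ) → (Fin (m + 1) → G) → (Fin (m + 1) → G) → ℂ)
    (hfA : ∀ (x y : X) (m : ℕ) (g1 g2 : Fin (m + 1) → G),
      fA x y m g1 g2 =
        Matrix.trace (B x y * (τ1 (g1 (Fin.last m)) ⊗ₖ τ2 (g2 (Fin.last m))) *
          (List.ofFn fun i : Fin m =>
            A * (τ1 (g1 i.castSucc) ⊗ₖ τ2 (g2 i.castSucc))).reverse.prod))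
    -- the correlator k_A at sequence length m + 1
    (kA : ℕ → ℂ)
    (hkA : ∀ m : ℕ,
      kA m = ((Fintype.card G : ℂ) ^ (2 * (m + 1)))⁻¹ *
        ∑ g1 : Fin (m + 1) → G, ∑ g2 : Fin (m + 1) → G, ∑ x : X, ∑ y : X,
          fA x y m g1 g2 * p x (m + 1) g1 * p y (m + 1) g2)
    -- the group-averaged projector P
    (P : Matrix ((Fin d1 × Fin d2) × Fin D × Fin D) ((Fin d1 × Fin d2) × Fin D × Fin D) ℂ)
    (hP : P = ((Fintype.card G : ℂ) ^ 2)⁻¹ •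
      ∑ g : G, ∑ h : G, (τ1 g ⊗ₖ τ2 h) ⊗ₖ (ω g ⊗ₖ ω h))
    -- the SPAM matrix Θ
    (Θ : Matrix ((Fin d1 × Fin d2) × Fin D × Fin D) ((Fin d1 × Fin d2) × Fin D × Fin D) ℂ)
    (hΘ : Θ = P * (∑ x : X, ∑ y : X,
      B x y ⊗ₖ (vecMulVec (ΛR.mulVec ρ) (ℓ x ᵥ* ΛL) ⊗ₖ vecMulVec (ΛR.mulVec ρ) (ℓ y ᵥ* ΛL))) * P)
    -- single-copy assumptions
    (hPne : P ≠ 0)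
    (hscalar : ∀ M : Matrix ((Fin d1 × Fin d2) × Fin D × Fin D)
        ((Fin d1 × Fin d2) × Fin D × Fin D) ℂ, ∃ c : ℂ, P * M * P = c • P) :
    Matrix.trace P ≠ 0 ∧
      ∀ m : ℕ, kA m = Matrix.trace Θ *
        (Matrix.trace (P * (A ⊗ₖ (Λ ⊗ₖ Λ)) * P) / Matrix.trace P) ^ m := by
  classical
  have hN : (Fintype.card G : ℂ) ≠ 0 := by exact_mod_cast Fintype.card_ne_zero
  set N : ℂ := (Fintype.card G : ℂ) with hNdef
  set U : G → G → Matrix ((Fin d1 × Fin d2) × Fin D × Fin D) ((Fin d1 × Fin d2) × Fin D × Fin D) ℂ :=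
    fun g h => (τ1 g ⊗ₖ τ2 h) ⊗ₖ (ω g ⊗ₖ ω h) with hU
  have hUmul : ∀ a b c d, U a b * U c d = U (a * c) (b * d) := by
    intro a b c d
    simp only [hU, hω, hτ1, hτ2, Matrix.mul_kronecker_mul]
  have hSum : ∑ g, ∑ h, U g h = N ^ 2 • P := by
    rw [hP, smul_smul, mul_inv_cancel₀ (pow_ne_zero 2 hN), one_smul]
  have hUP : ∀ a b, U a b * ∑ g, ∑ h, U g h = ∑ g, ∑ h, U g h := by
    intro a b
    simp_rw [Finset.mul_sum, hUmul]
    refine (Equiv.sum_comp (Equiv.mulLeft a) (fun g => ∑ h, U g (b * h))).trans ?_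
    exact Finset.sum_congr rfl fun g _ => Equiv.sum_comp (Equiv.mulLeft b) (fun h => U g h)
  have hUP' : ∀ a b, U a b * P = P := by
    intro a b
    have := hUP a b
    rw [hSum, Matrix.mul_smul] at this
    exact smul_right_injective _ (pow_ne_zero 2 hN) this
  have hPP : P * P = P := by
    have h1 : (∑ g, ∑ h, U g h) * P = N ^ 2 • P := by
      simp_rw [Finset.sum_mul, hUP']
      simp [hNdef, ← Nat.cast_smul_eq_nsmul ℂ, smul_smul, pow_two]
    rw [hSum, Matrix.smul_mul] at h1
    exact smul_right_injective _ (pow_ne_zero 2 hN) h1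
  have hcyc : ∀ M, trace (P * M * P) = trace (P * M) := by
    intro M
    rw [Matrix.trace_mul_comm, ← Matrix.mul_assoc, hPP]
  have htr : trace P ≠ 0 := by
    intro h0
    apply hPne
    have h1 : ∀ M, trace (P * M) = 0 := by
      intro M
      obtain ⟨c, hc⟩ := hscalar M
      rw [← hcyc, hc, trace_smul, h0, smul_zero]
    ext i j
    have h2 := h1 (Matrix.single j i 1)
    simpa [Matrix.trace_mul_single] using h2
  refine ⟨htr, fun m => ?_⟩
  set K := A ⊗ₖ (Λ ⊗ₖ Λ) with hK
  obtain ⟨c, hc⟩ := hscalar K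
  have hcval : trace (P * K * P) / trace P = c := by
    rw [hc, trace_smul, smul_eq_mul, mul_div_cancel_right₀ _ htr]
  rw [hcval]
  have hpow : ∀ m : ℕ, P * (K * P) ^ m = c ^ m • P := by
    intro m
    induction m with
    | zero => simp
    | succ m ih =>
      rw [pow_succ, ← Matrix.mul_assoc, ih, Matrix.smul_mul, ← Matrix.mul_assoc, hc, smul_smul,
        pow_succ]
  set W : X → X → Matrix ((Fin d1 × Fin d2) × Fin D × Fin D) ((Fin d1 × Fin d2) × Fin D × Fin D) ℂ :=
    fun x y => B x y ⊗ₖ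
      (vecMulVec (ΛR.mulVec ρ) (ℓ x ᵥ* ΛL) ⊗ₖ vecMulVec (ΛR.mulVec ρ) (ℓ y ᵥ* ΛL)) with hW
  have hterm : ∀ (g1 g2 : Fin (m + 1) → G) x y,
      fA x y m g1 g2 * p x (m + 1) g1 * p y (m + 1) g2 =
        trace (W x y * (U (g1 (Fin.last m)) (g2 (Fin.last m)) *
          (List.ofFn fun i : Fin m => K * U (g1 i.castSucc) (g2 i.castSucc)).reverse.prod)) := by
    intro g1 g2 x y
    rw [hfA, hp, hp, aux_shift ΛL ΛR m (fun i => ω (g1 i)), aux_shift ΛL ΛR m (fun i => ω (g2 i)),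
      aux_tr, aux_tr, ← hΛ]
    simp only [hK, hU, hW]
    simp_rw [← Matrix.mul_kronecker_mul]
    rw [aux_kron, aux_kron]
    simp_rw [← Matrix.mul_kronecker_mul]
    rw [Matrix.trace_kronecker, Matrix.trace_kronecker, mul_assoc, Matrix.mul_assoc]
  have hsum : ∑ g1 : Fin (m + 1) → G, ∑ g2 : Fin (m + 1) → G,
      U (g1 (Fin.last m)) (g2 (Fin.last m)) *
          (List.ofFn fun i : Fin m => K * U (g1 i.castSucc) (g2 i.castSucc)).reverse.prod
      = (N ^ (2 * (m + 1)) * c ^ m) • P := by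
    rw [aux_sum_succ2 m U (fun g h => (List.ofFn fun i : Fin m => K * U (g i) (h i)).reverse.prod),
      aux_sum_pow (fun a b => K * U a b) m]
    simp_rw [← Finset.mul_sum]
    rw [hSum, Matrix.mul_smul, smul_pow, Matrix.smul_mul, Matrix.mul_smul, hpow, smul_smul,
      smul_smul]
    congr 1
    ring
  rw [hkA]
  have hΘtr : trace Θ = trace ((∑ x, ∑ y, W x y) * P) := by
    rw [hΘ, hcyc, Matrix.trace_mul_comm]
  have hfin : ∑ g1 : Fin (m + 1) → G, ∑ g2 : Fin (m + 1) → G, ∑ x : X, ∑ y : X,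
          fA x y m g1 g2 * p x (m + 1) g1 * p y (m + 1) g2
      = trace ((∑ x, ∑ y, W x y) * ((N ^ (2 * (m + 1)) * c ^ m) • P)) := by
    rw [← hsum]
    simp_rw [hterm, Finset.mul_sum, Matrix.trace_sum, Finset.sum_mul, Matrix.trace_sum]
  rw [hfin, hΘtr, Matrix.mul_smul, trace_smul, smul_eq_mul, ← mul_assoc, ← mul_assoc,
    inv_mul_cancel₀ (pow_ne_zero _ hN), one_mul, mul_comm]
end

section
/- Fix an integer n ≥ 1 and let d = 2^n. Let G be a finite subgroup of the d×d unitary matrices satisfying the unitary 2-design conditions: (i) for every X ∈ M_d(ℂ), (1/|G|)·Σ_{g∈G} g X g† = (Tr X/d)·I_d, and (ii) for all traceless X, Y ∈ M_d(ℂ), (1/|G|)·Σ_{g∈G} (g X g†)⊗(g Y g†) = (Tr(XY)/(d²−1))·(F − I_{d²}/d). Let V, W be nontrivial Pauli strings, U ∈ M_d(ℂ) a unitary matrix, ρ ∈ M_d(ℂ) with Tr ρ = 1, X a finite set, and E_x ∈ M_d(ℂ) for each x ∈ X. For g ∈ G let τ(g) denote the (d²−1)×(d²−1) matrix indexed by 𝒫⁰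 with entries [τ(g)]_{σ,σ'} = Tr(σ·g σ' g†). Let A be the matrix indexed by 𝒫⁰×𝒫⁰ with entries A_{(σ₁,σ₂),(σ₁',σ₂')} = (d²−1)²·Tr(Wσ₁Wσ₁)·δ_{σ₁,σ₂}·Tr(Vσ₁')·Tr(Vσ₂'), and for x,y ∈ X let B_{xy} have entries [B_{xy}]_{(σ₁,σ₂),(σ₁',σ₂')} = Tr(σ₁ρ)·Tr(E_x σ₁')·Tr(σ₂ρ)·Tr(E_y σ₂'). For g⃗ = (g_1,…,g_m) ∈ G^m define p(x,g⃗) = Tr(E_x · g_m U g_{m−1} U ⋯ g_2 U g_1 U ρ U† g_1† U† g_2† ⋯ U† g_{m−1}† U† g_m†), and for g⃗¹, g⃗² ∈ G^m define f_A(x,y,g⃗¹,g⃗²) = Tr( B_{xy}·(τ(g¹_m)⊗τ(g²_m))·∏_{i=m−1}^{1}[A·(τ(g¹_i)⊗τ(g²_i))] ). Set k_A(m) = |G|^{−2m} Σ_{g⃗¹,g⃗²∈G^m} Σ_{x,y∈X} f_A(x,y,g⃗¹,g⃗²)·p(x,g⃗¹)·p(y,g⃗²). Then there exists a ∈ ℂ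 (depending on all the data but not on m) such that for every m ≥ 1, k_A(m) = a·( Tr(W·U V U†·W·U V U†) )^{m−1}; that is, the correlator decays exponentially in m with decay parameter d·O(t), where O(t) = (1/d)Tr(W·UVU†·W·UVU†) is the out-of-time-ordered correlator. -/
open Matrix Kronecker BigOperators

noncomputable section

/-- The 2×2 Pauli matrices `I₂, X, Y, Z`, indexed by `Fin 4`. -/
def pauli : Fin 4 → Matrix (Fin 2) (Fin 2) ℂ
  | 0 => 1
  | 1 => !![0, 1; 1, 0]
  | 2 => !![0, -Complex.I; Complex.I, 0]
  | 3 => !![1, 0; 0, -1]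

/-- The Pauli string `pauli (s 0) ⊗ ⋯ ⊗ pauli (s (n-1))`, realized as a matrix on
`ℂ^{2^n}` with the index set `Fin n → Fin 2` (so `d = 2^n`).  The string is trivial
(equal to `I_d`) exactly when `s = fun _ => 0`. -/
def pauliString {n : ℕ} (s : Fin n → Fin 4) :
    Matrix (Fin n → Fin 2) (Fin n → Fin 2) ℂ :=
  Matrix.of fun i j => ∏ k : Fin n, pauli (s k) (i k) (j k)

/-- The normalized Pauli operator `σ_s / √d` with `d = 2^n`; these form the
orthonormal basis `𝒫` of `M_d(ℂ)` for the Hilbert–Schmidt inner product. -/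
def normPauli {n : ℕ} (s : Fin n → Fin 4) :
    Matrix (Fin n → Fin 2) (Fin n → Fin 2) ℂ :=
  ((Real.sqrt (2 ^ n) : ℂ))⁻¹ • pauliString s

/-- The swap operator `F` on `ℂ^d ⊗ ℂ^d`, determined by `F (u ⊗ v) = v ⊗ u`. -/
def swapOp (I : Type*) [DecidableEq I] : Matrix (I × I) (I × I) ℂ :=
  Matrix.of fun p q => if p.1 = q.2 ∧ p.2 = q.1 then 1 else 0

/-- The index set labelling the normalized nontrivial Pauli operators `𝒫⁰`. -/
abbrev P0 (n : ℕ) := {s : Fin n → Fin 4 // s ≠ fun _ => 0}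

/-- The adjoint-representation matrix `τ(g)`, indexed by `𝒫⁰`, with entries
`[τ(g)]_{σ,σ'} = Tr(σ · g σ' g†)`. -/
def tauAd {n : ℕ} (g : Matrix (Fin n → Fin 2) (Fin n → Fin 2) ℂ) :
    Matrix (P0 n) (P0 n) ℂ :=
  Matrix.of fun σ σ' => Matrix.trace (normPauli σ.1 * (g * normPauli σ'.1 * gᴴ))

/-- Tensor product of a family of 2×2 matrices. -/
def tens {n : ℕ} (f : Fin n → Matrix (Fin 2) (Fin 2) ℂ) :
    Matrix (Fin n → Fin 2) (Fin n → Fin 2) ℂ :=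
  Matrix.of fun i j => ∏ k : Fin n, f k (i k) (j k)

lemma tens_mul {n : ℕ} (f g : Fin n → Matrix (Fin 2) (Fin 2) ℂ) :
    tens f * tens g = tens (fun k => f k * g k) := by
  ext i j
  simp only [tens, Matrix.mul_apply, Matrix.of_apply, Finset.prod_univ_sum,
    Fintype.piFinset_univ, Finset.prod_mul_distrib]

lemma tens_trace {n : ℕ} (f : Fin n → Matrix (Fin 2) (Fin 2) ℂ) :
    Matrix.trace (tens f) = ∏ k, Matrix.trace (f k) := by
  simp only [tens, Matrix.trace, Matrix.diag_apply, Matrix.of_apply, Finset.prod_univ_sum,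
    Fintype.piFinset_univ]

lemma pauliString_eq {n : ℕ} (s : Fin n → Fin 4) :
    pauliString s = tens (fun k => pauli (s k)) := rfl

lemma pauli_trace4 (a b w : Fin 4) (h : a ≠ b) :
    Matrix.trace (pauli w * pauli a * pauli w * pauli b) = 0 := by
  fin_cases a <;> fin_cases b <;> first | exact absurd rfl h | skip
  all_goals fin_cases w <;>
    simp [pauli, Matrix.trace, Fin.sum_univ_two, Matrix.mul_apply, Matrix.one_apply] <;> ring

lemma pauli_trace1 (a : Fin 4) (h : a ≠ 0) : Matrix.trace (pauli a) = 0 := by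
  fin_cases a <;> simp_all [pauli, Matrix.trace, Fin.sum_univ_two]

lemma pauli_complete (i j k l : Fin 2) :
    ∑ a : Fin 4, pauli a i j * pauli a k l = if i = l ∧ j = k then 2 else 0 := by
  fin_cases i <;> fin_cases j <;> fin_cases k <;> fin_cases l <;>
    simp [pauli, Fin.sum_univ_four] <;> norm_num

lemma pauliString_trace4 {n : ℕ} (a b w : Fin n → Fin 4) (h : a ≠ b) :
    Matrix.trace (pauliString w * pauliString a * pauliString w * pauliString b) = 0 := by
  obtain ⟨k, hk⟩ := Function.ne_iff.mp h
  simp only [pauliString_eq, tens_mul, tens_trace]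
  exact Finset.prod_eq_zero (Finset.mem_univ k) (pauli_trace4 _ _ _ hk)

lemma pauliString_trace {n : ℕ} (a : Fin n → Fin 4) (h : a ≠ fun _ => 0) :
    Matrix.trace (pauliString a) = 0 := by
  obtain ⟨k, hk⟩ := Function.ne_iff.mp h
  simp only [pauliString_eq, tens_trace]
  exact Finset.prod_eq_zero (Finset.mem_univ k) (pauli_trace1 _ hk)

lemma pauliString_complete {n : ℕ} (i j k l : Fin n → Fin 2) :
    ∑ s : Fin n → Fin 4, pauliString s i j * pauliString s k l
      = if i = l ∧ j = k then (2 ^ n : ℂ) else 0 := by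
  have : ∑ s : Fin n → Fin 4, pauliString s i j * pauliString s k l
      = ∏ t : Fin n, ∑ a : Fin 4, pauli a (i t) (j t) * pauli a (k t) (l t) := by
    simp only [pauliString, Matrix.of_apply, Finset.prod_univ_sum,
      Fintype.piFinset_univ, Finset.prod_mul_distrib]
  rw [this]
  simp only [pauli_complete]
  split_ifs with h
  · obtain ⟨rfl, rfl⟩ := h
    simp
  · have : ∃ t, ¬ (i t = l t ∧ j t = k t) := by
      by_contra hh
      push Not at hh
      exact h ⟨funext fun t => (hh t).1, funext fun t => (hh t).2⟩
    obtain ⟨t, ht⟩ := this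
    exact Finset.prod_eq_zero (Finset.mem_univ t) (if_neg ht)

lemma sqrt_inv_sq (n : ℕ) :
    ((Real.sqrt (2 ^ n) : ℂ))⁻¹ * ((Real.sqrt (2 ^ n) : ℂ))⁻¹ = (2 ^ n : ℂ)⁻¹ := by
  rw [← mul_inv, ← Complex.ofReal_mul, Real.mul_self_sqrt (by positivity)]
  simp

lemma pauliString_zero {n : ℕ} : pauliString (fun _ : Fin n => (0 : Fin 4)) = 1 := by
  ext i j
  simp only [pauliString, pauli, Matrix.of_apply, Matrix.one_apply]
  split_ifs with h
  · subst h; simp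
  · obtain ⟨k, hk⟩ := Function.ne_iff.mp h
    exact Finset.prod_eq_zero (Finset.mem_univ k) (if_neg hk)

lemma complete_all {n : ℕ} (K L : Matrix (Fin n → Fin 2) (Fin n → Fin 2) ℂ) :
    ∑ s : Fin n → Fin 4, Matrix.trace (K * normPauli s) * Matrix.trace (normPauli s * L)
      = Matrix.trace (K * L) := by
  have h1 : ∀ s : Fin n → Fin 4,
      Matrix.trace (K * normPauli s) * Matrix.trace (normPauli s * L)
      = ∑ i, ∑ j, ∑ k, ∑ l, (2 ^ n : ℂ)⁻¹ * (K j i * L l k)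
          * (pauliString s i j * pauliString s k l) := by
    intro s
    rw [← sqrt_inv_sq, mul_comm (Matrix.trace (K * normPauli s))]
    simp only [normPauli, Matrix.mul_smul, Matrix.smul_mul, Matrix.trace_smul, smul_eq_mul]
    rw [Matrix.trace_mul_comm K]
    simp only [Matrix.trace, Matrix.diag_apply, Matrix.mul_apply]
    simp only [Finset.mul_sum, Finset.sum_mul]
    refine Finset.sum_congr rfl fun i _ => Finset.sum_congr rfl fun j _ =>
      Finset.sum_congr rfl fun k _ => Finset.sum_congr rfl fun l _ => ?_
    ring
  simp only [h1]
  have h2 : ∑ s : Fin n → Fin 4, ∑ i, ∑ j, ∑ k, ∑ l, (2 ^ n : ℂ)⁻¹ * (K j i * L l k)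
          * (pauliString s i j * pauliString s k l)
      = ∑ i, ∑ j, ∑ k, ∑ l, (2 ^ n : ℂ)⁻¹ * (K j i * L l k)
          * ∑ s : Fin n → Fin 4, (pauliString s i j * pauliString s k l) := by
    simp only [Finset.mul_sum]
    rw [Finset.sum_comm]; refine Finset.sum_congr rfl fun i _ => ?_
    rw [Finset.sum_comm]; refine Finset.sum_congr rfl fun j _ => ?_
    rw [Finset.sum_comm]; refine Finset.sum_congr rfl fun k _ => ?_
    rw [Finset.sum_comm]
  rw [h2]
  simp only [pauliString_complete]
  have h3 : ∀ i j k l : Fin n → Fin 2, (2 ^ n : ℂ)⁻¹ * (K j i * L l k) *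
      (if i = l ∧ j = k then (2 ^ n : ℂ) else 0)
      = if i = l then (if j = k then K j i * L i j else 0) else 0 := by
    intro i j k l
    by_cases h : i = l <;> by_cases h' : j = k <;> simp [h, h']
    field_simp
  simp only [h3]
  simp only [Finset.sum_ite_eq, Finset.mem_univ, if_true]
  rw [Finset.sum_comm]
  simp only [Matrix.trace, Matrix.diag_apply, Matrix.mul_apply]

lemma complete_P0 {n : ℕ} (K L : Matrix (Fin n → Fin 2) (Fin n → Fin 2) ℂ) :
    ∑ s : P0 n, Matrix.trace (K * normPauli s.1) * Matrix.trace (normPauli s.1 * L)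
      = Matrix.trace (K * L) - Matrix.trace K * Matrix.trace L / 2 ^ n := by
  rw [← complete_all K L]
  have h := Fintype.sum_subtype_add_sum_subtype (fun s : Fin n → Fin 4 => s ≠ fun _ => 0)
    (fun s => Matrix.trace (K * normPauli s) * Matrix.trace (normPauli s * L))
  rw [← h]
  have h0 : ∑ i : {s : Fin n → Fin 4 // ¬ s ≠ fun _ => 0},
      Matrix.trace (K * normPauli i.1) * Matrix.trace (normPauli i.1 * L)
      = Matrix.trace K * Matrix.trace L / 2 ^ n := by
    rw [Fintype.sum_eq_single ⟨fun _ => 0, by simp⟩]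
    · simp only [normPauli, pauliString_zero, Matrix.mul_smul, Matrix.smul_mul,
        Matrix.trace_smul, smul_eq_mul, mul_one, one_mul]
      rw [div_eq_mul_inv, ← sqrt_inv_sq]; ring
    · rintro ⟨x, hx⟩ hne
      exact absurd (Subtype.ext (not_not.mp hx)) hne
  rw [h0]; ring

lemma normPauli_trace {n : ℕ} (a : P0 n) : Matrix.trace (normPauli a.1) = 0 := by
  simp [normPauli, pauliString_trace a.1 a.2]

lemma otoc_expand {n : ℕ} (sW : Fin n → Fin 4)
    (M : Matrix (Fin n → Fin 2) (Fin n → Fin 2) ℂ) (hM : Matrix.trace M = 0) :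
    ∑ a : P0 n, Matrix.trace (pauliString sW * normPauli a.1 * pauliString sW * normPauli a.1)
      * (Matrix.trace (normPauli a.1 * M) * Matrix.trace (normPauli a.1 * M))
      = Matrix.trace (pauliString sW * M * pauliString sW * M) := by
  have h1 := complete_P0 (pauliString sW * M * pauliString sW) M
  rw [hM, mul_zero, zero_div, sub_zero] at h1
  rw [← h1]
  refine Finset.sum_congr rfl fun a _ => ?_
  have h2 : Matrix.trace (pauliString sW * M * pauliString sW * normPauli a.1)
      = Matrix.trace (M * (pauliString sW * normPauli a.1 * pauliString sW)) := by
    rw [Matrix.mul_assoc, Matrix.mul_assoc, Matrix.trace_mul_comm]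
    simp only [Matrix.mul_assoc]
  rw [h2]
  have h3 := complete_P0 M (pauliString sW * normPauli a.1 * pauliString sW)
  rw [hM, zero_mul, zero_div, sub_zero] at h3
  rw [← h3, Fintype.sum_eq_single a]
  · rw [Matrix.trace_mul_comm M, Matrix.trace_mul_comm (normPauli a.1) (_ * _)]; ring
  · intro b hb
    rw [Matrix.trace_mul_comm (normPauli b.1) (_ * _)]
    have : Matrix.trace (pauliString sW * normPauli a.1 * pauliString sW * normPauli b.1) = 0 := by
      simp only [normPauli, Matrix.mul_smul, Matrix.smul_mul, Matrix.trace_smul]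
      rw [pauliString_trace4 _ _ _ (fun h => hb (Subtype.ext h.symm))]
      simp
    rw [this, mul_zero]

lemma trace_kron_swap {I : Type*} [Fintype I] [DecidableEq I] (K L : Matrix I I ℂ) :
    Matrix.trace ((K ⊗ₖ L) * swapOp I) = Matrix.trace (K * L) := by
  simp only [Matrix.trace, Matrix.diag_apply, Matrix.mul_apply, Fintype.sum_prod_type,
    Matrix.kroneckerMap_apply, swapOp, Matrix.of_apply]
  have : ∀ x y z t : I, K x z * L y t * (if z = y ∧ t = x then (1 : ℂ) else 0)
      = if z = y then (if t = x then K x y * L y x else 0) else 0 := by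
    intro x y z t
    by_cases h : z = y <;> by_cases h' : t = x <;> simp [h, h']
  simp only [this, Finset.sum_ite_eq', Finset.sum_ite_irrel, Finset.sum_const_zero,
    Finset.mem_univ, if_true]

abbrev Mat (n : ℕ) := Matrix (Fin n → Fin 2) (Fin n → Fin 2) ℂ

lemma design_avg {n : ℕ} (G : Finset (Mat n))
    (hGone : (1 : Mat n) ∈ G)
    (hGunitary : ∀ g ∈ G, g * gᴴ = 1 ∧ gᴴ * g = 1)
    (hdesign1 : ∀ M : Mat n,
      (G.card : ℂ)⁻¹ • ∑ g ∈ G, g * M * gᴴ = (Matrix.trace M / (2 ^ n : ℂ)) • 1)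
    (hdesign2 : ∀ M N : Mat n,
      Matrix.trace M = 0 → Matrix.trace N = 0 →
      (G.card : ℂ)⁻¹ • ∑ g ∈ G, (g * M * gᴴ) ⊗ₖ (g * N * gᴴ) =
        (Matrix.trace (M * N) / ((2 ^ n : ℂ) ^ 2 - 1)) •
          (swapOp (Fin n → Fin 2) - ((2 ^ n : ℂ))⁻¹ • 1))
    (K L N M : Mat n) (hN : Matrix.trace N = 0) :
    ∑ g : {g // g ∈ G}, Matrix.trace (K * (g.1 * N * g.1ᴴ)) * Matrix.trace (L * (g.1 * M * g.1ᴴ))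
      = (G.card : ℂ) * (Matrix.trace (N * M) / ((2 ^ n : ℂ) ^ 2 - 1)) *
        (Matrix.trace (K * L) - Matrix.trace K * Matrix.trace L / 2 ^ n) := by
  have hc : (G.card : ℂ) ≠ 0 := by
    exact_mod_cast Finset.card_ne_zero_of_mem hGone
  rw [Finset.sum_coe_sort G (fun g : Mat n =>
    Matrix.trace (K * (g * N * gᴴ)) * Matrix.trace (L * (g * M * gᴴ)))]
  set t : ℂ := Matrix.trace M / 2 ^ n with ht
  set M0 : Mat n := M - t • 1 with hM0
  have htr1 : Matrix.trace (1 : Mat n) = 2 ^ n := by simp [Matrix.trace_one]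
  have hM0t : Matrix.trace M0 = 0 := by
    rw [hM0, Matrix.trace_sub, Matrix.trace_smul, htr1, ht, smul_eq_mul]
    field_simp; ring
  have hNM : Matrix.trace (N * M0) = Matrix.trace (N * M) := by
    simp [hM0, Matrix.mul_sub, hN]
  -- split
  have hsplit : ∀ g ∈ G, Matrix.trace (K * (g * N * gᴴ)) * Matrix.trace (L * (g * M * gᴴ))
      = Matrix.trace ((K ⊗ₖ L) * ((g * N * gᴴ) ⊗ₖ (g * M0 * gᴴ)))
        + (t * Matrix.trace L) * Matrix.trace (K * (g * N * gᴴ)) := by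
    intro g hg
    have : g * M * gᴴ = g * M0 * gᴴ + t • 1 := by
      rw [hM0, Matrix.mul_sub, Matrix.sub_mul]
      simp [(hGunitary g hg).1]
    rw [this, ← Matrix.mul_kronecker_mul, Matrix.trace_kronecker, Matrix.mul_add,
      Matrix.trace_add]
    simp; ring
  rw [Finset.sum_congr rfl hsplit, Finset.sum_add_distrib, ← Finset.mul_sum,
    ← Matrix.trace_sum, ← Matrix.trace_sum, ← Matrix.mul_sum, ← Matrix.mul_sum]
  have e1 : ∑ g ∈ G, g * N * gᴴ = 0 := by
    have := hdesign1 N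
    rw [hN, zero_div, zero_smul] at this
    exact (smul_eq_zero.mp this).resolve_left (inv_ne_zero hc)
  have e2 := hdesign2 N M0 hN hM0t
  rw [inv_smul_eq_iff₀ hc] at e2
  rw [e1, e2, hNM]
  simp only [Matrix.mul_smul, Matrix.trace_smul, Matrix.mul_sub, Matrix.trace_sub, trace_kron_swap,
    Matrix.mul_zero, Matrix.trace_zero, mul_one, Matrix.mul_one, Matrix.trace_kronecker, smul_eq_mul]
  ring

/-- The bilinear form `Tr(KL) - Tr K Tr L / d`. -/
def qf {n : ℕ} (K L : Mat n) : ℂ :=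
  Matrix.trace (K * L) - Matrix.trace K * Matrix.trace L / 2 ^ n

/-- The covector associated with a pair of operators. -/
def cov {n : ℕ} (K1 K2 : Mat n) : P0 n × P0 n → ℂ := fun q =>
  Matrix.trace (K1 * normPauli q.1.1) * Matrix.trace (K2 * normPauli q.2.1)

lemma tau_contract {n : ℕ} (K g : Mat n) (hg : gᴴ * g = 1) (c : P0 n) :
    ∑ i : P0 n, Matrix.trace (K * normPauli i.1) * tauAd g i c
      = Matrix.trace (K * (g * normPauli c.1 * gᴴ)) := by
  simp only [tauAd, Matrix.of_apply]
  rw [complete_P0]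
  have : Matrix.trace (g * normPauli c.1 * gᴴ) = 0 := by
    rw [Matrix.trace_mul_comm, ← Matrix.mul_assoc, hg, Matrix.one_mul, normPauli_trace]
  rw [this]; simp

lemma cov_contract {n : ℕ} (K1 K2 g h : Mat n) (hg : gᴴ * g = 1) (hh : hᴴ * h = 1)
    (r : P0 n × P0 n → ℂ) :
    cov K1 K2 ⬝ᵥ ((tauAd g ⊗ₖ tauAd h) *ᵥ r)
      = ∑ c : P0 n, ∑ d : P0 n, r (c, d) * (Matrix.trace (K1 * (g * normPauli c.1 * gᴴ)) *
          Matrix.trace (K2 * (h * normPauli d.1 * hᴴ))) := by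
  rw [Matrix.dotProduct_mulVec]
  simp only [dotProduct, Fintype.sum_prod_type]
  refine Finset.sum_congr rfl fun c _ => Finset.sum_congr rfl fun d _ => ?_
  rw [mul_comm, ← tau_contract K1 g hg, ← tau_contract K2 h hh, Finset.sum_mul_sum]
  congr 1
  simp only [Matrix.vecMul, dotProduct, Fintype.sum_prod_type, cov, Matrix.kroneckerMap_apply]
  refine Finset.sum_congr rfl fun i _ => Finset.sum_congr rfl fun j _ => ?_
  ring

lemma step_avg {n : ℕ} (G : Finset (Mat n))
    (hGunitary : ∀ g ∈ G, g * gᴴ = 1 ∧ gᴴ * g = 1) (D : ℂ)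
    (key : ∀ K L N M : Mat n, Matrix.trace N = 0 →
      ∑ g : {g // g ∈ G},
        Matrix.trace (K * (g.1 * N * g.1ᴴ)) * Matrix.trace (L * (g.1 * M * g.1ᴴ))
      = (G.card : ℂ) * (Matrix.trace (N * M) / D) * qf K L)
    (K1 K2 L1 L2 M1 M2 : Mat n) (r : P0 n × P0 n → ℂ) :
    ∑ g : {g // g ∈ G}, ∑ h : {g // g ∈ G},
      (cov K1 K2 ⬝ᵥ ((tauAd g.1 ⊗ₖ tauAd h.1) *ᵥ r)) *
        Matrix.trace (L1 * (g.1 * M1 * g.1ᴴ)) * Matrix.trace (L2 * (h.1 * M2 * h.1ᴴ))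
    = (G.card : ℂ) ^ 2 * (D⁻¹ ^ 2 * ∑ c : P0 n, ∑ d : P0 n, r (c, d) *
        (Matrix.trace (normPauli c.1 * M1) * Matrix.trace (normPauli d.1 * M2))) *
        (qf K1 L1 * qf K2 L2) := by
  have h1 : ∀ g h : {g // g ∈ G}, (cov K1 K2 ⬝ᵥ ((tauAd g.1 ⊗ₖ tauAd h.1) *ᵥ r)) *
        Matrix.trace (L1 * (g.1 * M1 * g.1ᴴ)) * Matrix.trace (L2 * (h.1 * M2 * h.1ᴴ))
      = ∑ c : P0 n, ∑ d : P0 n, r (c, d) *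
        ((Matrix.trace (K1 * (g.1 * normPauli c.1 * g.1ᴴ)) *
            Matrix.trace (L1 * (g.1 * M1 * g.1ᴴ))) *
          (Matrix.trace (K2 * (h.1 * normPauli d.1 * h.1ᴴ)) *
            Matrix.trace (L2 * (h.1 * M2 * h.1ᴴ)))) := by
    intro g h
    rw [cov_contract _ _ _ _ (hGunitary g.1 g.2).2 (hGunitary h.1 h.2).2]
    simp only [Finset.sum_mul]
    refine Finset.sum_congr rfl fun c _ => Finset.sum_congr rfl fun d _ => ?_
    ring
  simp only [h1]
  have h2 : ∀ F : {g // g ∈ G} → {g // g ∈ G} → P0 n → P0 n → ℂ,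
      ∑ g, ∑ h, ∑ c, ∑ d, F g h c d = ∑ c, ∑ d, ∑ g, ∑ h, F g h c d := by
    intro F
    have : ∀ g, ∑ h, ∑ c, ∑ d, F g h c d = ∑ c, ∑ d, ∑ h, F g h c d := by
      intro g
      rw [Finset.sum_comm]
      refine Finset.sum_congr rfl fun c _ => ?_
      rw [Finset.sum_comm]
    simp only [this]
    rw [Finset.sum_comm]
    refine Finset.sum_congr rfl fun c _ => ?_
    rw [Finset.sum_comm]
  rw [h2]
  simp only [Finset.mul_sum, Finset.sum_mul]
  refine Finset.sum_congr rfl fun c _ => Finset.sum_congr rfl fun d _ => ?_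
  simp only [← Finset.mul_sum]
  rw [← Finset.sum_mul, key _ _ _ _ (normPauli_trace c), key _ _ _ _ (normPauli_trace d)]
  ring

/-- Transfer product appearing in the correlation function. -/
def transProd {n : ℕ} {G : Finset (Mat n)} (A : Matrix (P0 n × P0 n) (P0 n × P0 n) ℂ) (m : ℕ)
    (g1 g2 : Fin (m + 1) → {g // g ∈ G}) : Matrix (P0 n × P0 n) (P0 n × P0 n) ℂ :=
  (tauAd (g1 (Fin.last m)).1 ⊗ₖ tauAd (g2 (Fin.last m)).1) *
    (List.ofFn fun i : Fin m => A * (tauAd (g1 i.castSucc).1 ⊗ₖ tauAd (g2 i.castSucc).1)).reverse.prod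

/-- Evolved state. -/
def evol {n : ℕ} {G : Finset (Mat n)} (U M : Mat n) (m : ℕ) (g : Fin m → {g // g ∈ G}) : Mat n :=
  (List.ofFn fun i : Fin m => (g i).1 * U).reverse.prod * M *
    (List.ofFn fun i : Fin m => Uᴴ * ((g i).1)ᴴ).prod

lemma transProd_cons {n : ℕ} {G : Finset (Mat n)} (A : Matrix (P0 n × P0 n) (P0 n × P0 n) ℂ) (m : ℕ)
    (a b : {g // g ∈ G}) (g1 g2 : Fin (m + 1) → {g // g ∈ G}) :
    transProd A (m + 1) (Fin.cons a g1) (Fin.cons b g2)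
      = transProd A m g1 g2 * (A * (tauAd a.1 ⊗ₖ tauAd b.1)) := by
  simp only [transProd, List.ofFn_succ, List.reverse_cons, List.prod_append, List.prod_singleton,
    ← Fin.succ_last, Fin.cons_succ, Fin.castSucc_zero, Fin.cons_zero, ← Fin.succ_castSucc,
    Matrix.mul_assoc]

lemma evol_cons {n : ℕ} {G : Finset (Mat n)} (U M : Mat n) (m : ℕ) (a : {g // g ∈ G})
    (g : Fin m → {g // g ∈ G}) :
    evol U M (m + 1) (Fin.cons a g) = evol U (a.1 * (U * M * Uᴴ) * a.1ᴴ) m g := by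
  simp only [evol, List.ofFn_succ, List.reverse_cons, List.prod_append, List.prod_singleton,
    List.prod_cons, List.prod_nil, Matrix.one_mul, Fin.cons_succ, Fin.cons_zero, Matrix.mul_assoc]

lemma sum_cons {α : Type*} [Fintype α] (m : ℕ) (F : (Fin (m + 1) → α) → ℂ) :
    ∑ g, F g = ∑ a : α, ∑ g : Fin m → α, F (Fin.cons a g) := by
  rw [← (Fin.consEquiv (fun _ : Fin (m + 1) => α)).sum_comp, Fintype.sum_prod_type]
  rfl

lemma main_ind {n : ℕ} (G : Finset (Mat n))
    (hGunitary : ∀ g ∈ G, g * gᴴ = 1 ∧ gᴴ * g = 1) (D : ℂ) (hD : D ≠ 0)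
    (key : ∀ K L N M : Mat n, Matrix.trace N = 0 →
      ∑ g : {g // g ∈ G},
        Matrix.trace (K * (g.1 * N * g.1ᴴ)) * Matrix.trace (L * (g.1 * M * g.1ᴴ))
      = (G.card : ℂ) * (Matrix.trace (N * M) / D) * qf K L)
    (sV sW : Fin n → Fin 4) (hV : sV ≠ fun _ => 0) (U : Mat n) (hU' : Uᴴ * U = 1)
    (A : Matrix (P0 n × P0 n) (P0 n × P0 n) ℂ)
    (hA : ∀ σ₁ σ₂ σ₁' σ₂' : P0 n, A (σ₁, σ₂) (σ₁', σ₂') =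
      D ^ 2 *
        Matrix.trace (pauliString sW * normPauli σ₁.1 * pauliString sW * normPauli σ₁.1) *
        (if σ₁ = σ₂ then 1 else 0) *
        Matrix.trace (pauliString sV * normPauli σ₁'.1) *
        Matrix.trace (pauliString sV * normPauli σ₂'.1))
    (E1 E2 : Mat n) (m : ℕ) : ∀ (r : P0 n × P0 n → ℂ) (M1 M2 : Mat n),
    ∑ g1 : Fin (m + 1) → {g // g ∈ G}, ∑ g2 : Fin (m + 1) → {g // g ∈ G},
      (cov E1 E2 ⬝ᵥ (transProd A m g1 g2 *ᵥ r)) * Matrix.trace (E1 * evol U M1 (m + 1) g1) *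
        Matrix.trace (E2 * evol U M2 (m + 1) g2)
    = (G.card : ℂ) ^ (2 * (m + 1)) * (D⁻¹ ^ 2 * ∑ c : P0 n, ∑ d : P0 n, r (c, d) *
        (Matrix.trace (normPauli c.1 * (U * M1 * Uᴴ)) *
          Matrix.trace (normPauli d.1 * (U * M2 * Uᴴ)))) *
        (qf E1 E1 * qf E2 E2) *
      (Matrix.trace (pauliString sW * (U * pauliString sV * Uᴴ) *
        pauliString sW * (U * pauliString sV * Uᴴ))) ^ m := by
  induction m with
  | zero =>
    intro r M1 M2
    have h := step_avg G hGunitary D key E1 E2 E1 E2 (U * M1 * Uᴴ) (U * M2 * Uᴴ) r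
    rw [pow_zero, mul_one, show 2 * (0 + 1) = 2 from rfl, ← h, sum_cons]
    refine Finset.sum_congr rfl fun a _ => ?_
    rw [Fintype.sum_unique, sum_cons]
    refine Finset.sum_congr rfl fun b _ => ?_
    rw [Fintype.sum_unique, evol_cons, evol_cons]
    simp [evol, transProd]
  | succ m ih =>
    intro r M1 M2
    set V := pauliString sV with hVdef
    have hVt : Matrix.trace V = 0 := pauliString_trace sV hV
    rw [sum_cons]
    have hAr : ∀ (s : P0 n × P0 n → ℂ) (a b : P0 n), (A *ᵥ s) (a, b)
        = D ^ 2 * Matrix.trace (pauliString sW * normPauli a.1 * pauliString sW * normPauli a.1) *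
          (if a = b then 1 else 0) * (cov V V ⬝ᵥ s) := by
      intro s a b
      simp only [Matrix.mulVec, dotProduct, Fintype.sum_prod_type, hA, cov, Finset.mul_sum]
      refine Finset.sum_congr rfl fun i _ => Finset.sum_congr rfl fun j _ => ?_
      ring
    have h1 : ∀ a : {g // g ∈ G}, ∑ g1 : Fin (m + 1) → {g // g ∈ G},
        ∑ g2 : Fin (m + 1 + 1) → {g // g ∈ G},
        (cov E1 E2 ⬝ᵥ (transProd A (m + 1) (Fin.cons a g1) g2 *ᵥ r)) *
          Matrix.trace (E1 * evol U M1 (m + 1 + 1) (Fin.cons a g1)) *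
          Matrix.trace (E2 * evol U M2 (m + 1 + 1) g2)
        = ∑ b : {g // g ∈ G}, ∑ e : P0 n, ((G.card : ℂ) ^ (2 * (m + 1)) * (qf E1 E1 * qf E2 E2) *
            (Matrix.trace (pauliString sW * (U * V * Uᴴ) *
              pauliString sW * (U * V * Uᴴ))) ^ m *
            Matrix.trace (pauliString sW * normPauli e.1 * pauliString sW * normPauli e.1)) *
            ((cov V V ⬝ᵥ ((tauAd a.1 ⊗ₖ tauAd b.1) *ᵥ r)) *
              Matrix.trace ((Uᴴ * normPauli e.1 * U) * (a.1 * (U * M1 * Uᴴ) * a.1ᴴ)) *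
              Matrix.trace ((Uᴴ * normPauli e.1 * U) * (b.1 * (U * M2 * Uᴴ) * b.1ᴴ))) := by
      intro a
      simp only [sum_cons (m + 1)]
      rw [Finset.sum_comm]
      refine Finset.sum_congr rfl fun b _ => ?_
      simp only [transProd_cons, evol_cons, ← Matrix.mulVec_mulVec]
      rw [ih]
      simp only [hAr]
      have hcyc : ∀ (e : P0 n) (Y : Mat n), Matrix.trace (normPauli e.1 * (U * Y * Uᴴ))
          = Matrix.trace ((Uᴴ * normPauli e.1 * U) * Y) := by
        intro e Y
        rw [← Matrix.mul_assoc, Matrix.trace_mul_comm]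
        simp only [Matrix.mul_assoc]
      simp only [hcyc]
      simp only [Finset.mul_sum, Finset.sum_mul]
      refine Finset.sum_congr rfl fun e _ => ?_
      rw [Fintype.sum_eq_single e]
      · rw [if_pos rfl]
        field_simp
      · intro f hf
        rw [if_neg (Ne.symm hf)]; ring
    simp only [h1]
    have h2 : ∀ F : {g // g ∈ G} → {g // g ∈ G} → P0 n → ℂ,
        ∑ g, ∑ h, ∑ c, F g h c = ∑ c, ∑ g, ∑ h, F g h c := by
      intro F
      have : ∀ g, ∑ h, ∑ c, F g h c = ∑ c, ∑ h, F g h c := fun g => Finset.sum_comm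
      simp only [this]
      exact Finset.sum_comm
    rw [h2]
    simp only [← Finset.mul_sum]
    simp only [step_avg G hGunitary D key]
    have hq : ∀ e : P0 n, qf V (Uᴴ * normPauli e.1 * U)
        = Matrix.trace (normPauli e.1 * (U * V * Uᴴ)) := by
      intro e
      rw [qf, hVt, zero_mul, zero_div, sub_zero, Matrix.trace_mul_comm,
        ← Matrix.mul_assoc (normPauli e.1), Matrix.trace_mul_comm _ Uᴴ]
      simp only [Matrix.mul_assoc]
    simp only [hq]
    have hUVU : Matrix.trace (U * V * Uᴴ) = 0 := by
      rw [Matrix.trace_mul_comm, ← Matrix.mul_assoc, hU', Matrix.one_mul, hVt]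
    have ho := otoc_expand sW (U * V * Uᴴ) hUVU
    generalize (∑ c : P0 n, ∑ d : P0 n, r (c, d) *
        (Matrix.trace (normPauli c.1 * (U * M1 * Uᴴ)) *
          Matrix.trace (normPauli d.1 * (U * M2 * Uᴴ)))) = S
    rw [pow_succ (Matrix.trace _) m]
    nth_rewrite 3 [← ho]
    rw [Finset.mul_sum, Finset.mul_sum]
    refine Finset.sum_congr rfl fun e _ => ?_
    ring

/-- Corollary 1 of the paper: for a unitary 2-design gate set `G` with a fixed unitary `U`
inserted between consecutive random gates, the OTOC correlator decays as
`k_A(m) = a·(Tr(W·UVU†·W·UVU†))^{m-1} = a·(d·O(t))^{m-1}`.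
Sequence length `m ≥ 1` is represented as `m + 1`. -/
theorem statement5 (n : ℕ) (hn : 1 ≤ n)
    -- G is a finite subgroup of the unitary group
    (G : Finset (Matrix (Fin n → Fin 2) (Fin n → Fin 2) ℂ))
    (hGone : (1 : Matrix (Fin n → Fin 2) (Fin n → Fin 2) ℂ) ∈ G)
    (hGmul : ∀ g ∈ G, ∀ h ∈ G, g * h ∈ G)
    (hGinv : ∀ g ∈ G, gᴴ ∈ G)
    (hGunitary : ∀ g ∈ G, g * gᴴ = 1 ∧ gᴴ * g = 1)
    -- the unitary 2-design conditions
    (hdesign1 : ∀ M : Matrix (Fin n → Fin 2) (Fin n → Fin 2) ℂ,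
      (G.card : ℂ)⁻¹ • ∑ g ∈ G, g * M * gᴴ = (Matrix.trace M / (2 ^ n : ℂ)) • 1)
    (hdesign2 : ∀ M N : Matrix (Fin n → Fin 2) (Fin n → Fin 2) ℂ,
      Matrix.trace M = 0 → Matrix.trace N = 0 →
      (G.card : ℂ)⁻¹ • ∑ g ∈ G, (g * M * gᴴ) ⊗ₖ (g * N * gᴴ) =
        (Matrix.trace (M * N) / ((2 ^ n : ℂ) ^ 2 - 1)) •
          (swapOp (Fin n → Fin 2) - ((2 ^ n : ℂ))⁻¹ • 1))
    -- nontrivial Pauli strings V and W, a unitary U, a state ρ, and a POVM {E_x}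
    (sV sW : Fin n → Fin 4) (hV : sV ≠ fun _ => 0) (hW : sW ≠ fun _ => 0)
    (U : Matrix (Fin n → Fin 2) (Fin n → Fin 2) ℂ)
    (hU : U * Uᴴ = 1) (hU' : Uᴴ * U = 1)
    (ρ : Matrix (Fin n → Fin 2) (Fin n → Fin 2) ℂ) (hρ : Matrix.trace ρ = 1)
    (X : Type) [Fintype X] (E : X → Matrix (Fin n → Fin 2) (Fin n → Fin 2) ℂ)
    -- the matrix A
    (A : Matrix (P0 n × P0 n) (P0 n × P0 n) ℂ)
    (hA : ∀ σ₁ σ₂ σ₁' σ₂' : P0 n, A (σ₁, σ₂) (σ₁', σ₂') =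
      ((2 ^ n : ℂ) ^ 2 - 1) ^ 2 *
        Matrix.trace (pauliString sW * normPauli σ₁.1 * pauliString sW * normPauli σ₁.1) *
        (if σ₁ = σ₂ then 1 else 0) *
        Matrix.trace (pauliString sV * normPauli σ₁'.1) *
        Matrix.trace (pauliString sV * normPauli σ₂'.1))
    -- the matrices B_{xy}
    (B : X → X → Matrix (P0 n × P0 n) (P0 n × P0 n) ℂ)
    (hB : ∀ (x y : X) (σ₁ σ₂ σ₁' σ₂' : P0 n), B x y (σ₁, σ₂) (σ₁', σ₂') =
      Matrix.trace (normPauli σ₁.1 * ρ) * Matrix.trace (E x * normPauli σ₁'.1) *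
        Matrix.trace (normPauli σ₂.1 * ρ) * Matrix.trace (E y * normPauli σ₂'.1))
    -- the outcome probability p(x, g⃗) = Tr(E_x · g_m U ⋯ g_1 U ρ U† g_1† ⋯ U† g_m†)
    (p : X → (m : ℕ) → (Fin m → {g // g ∈ G}) → ℂ)
    (hp : ∀ (x : X) (m : ℕ) (g : Fin m → {g // g ∈ G}),
      p x m g = Matrix.trace (E x *
        ((List.ofFn fun i : Fin m =>
            (g i : Matrix (Fin n → Fin 2) (Fin n → Fin 2) ℂ) * U).reverse.prod * ρ *
          (List.ofFn fun i : Fin m =>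
            Uᴴ * ((g i : Matrix (Fin n → Fin 2) (Fin n → Fin 2) ℂ))ᴴ).prod)))
    -- the second-order sequence correlation function f_A
    (fA : X → X → (m : ℕ) → (Fin (m + 1) → {g // g ∈ G}) → (Fin (m + 1) → {g // g ∈ G}) → ℂ)
    (hfA : ∀ (x y : X) (m : ℕ) (g1 g2 : Fin (m + 1) → {g // g ∈ G}),
      fA x y m g1 g2 =
        Matrix.trace (B x y * (tauAd (g1 (Fin.last m) : Matrix (Fin n → Fin 2) (Fin n → Fin 2) ℂ)
            ⊗ₖ tauAd (g2 (Fin.last m) : Matrix (Fin n → Fin 2) (Fin n → Fin 2) ℂ)) *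
          (List.ofFn fun i : Fin m =>
            A * (tauAd (g1 i.castSucc : Matrix (Fin n → Fin 2) (Fin n → Fin 2) ℂ)
              ⊗ₖ tauAd (g2 i.castSucc : Matrix (Fin n → Fin 2) (Fin n → Fin 2) ℂ))).reverse.prod))
    -- the correlator k_A at sequence length m + 1
    (kA : ℕ → ℂ)
    (hkA : ∀ m : ℕ,
      kA m = ((G.card : ℂ) ^ (2 * (m + 1)))⁻¹ *
        ∑ g1 : Fin (m + 1) → {g // g ∈ G}, ∑ g2 : Fin (m + 1) → {g // g ∈ G},
          ∑ x : X, ∑ y : X, fA x y m g1 g2 * p x (m + 1) g1 * p y (m + 1) g2) :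
    ∃ a : ℂ, ∀ m : ℕ,
      kA m = a * (Matrix.trace (pauliString sW * (U * pauliString sV * Uᴴ) *
        pauliString sW * (U * pauliString sV * Uᴴ))) ^ m := by
  have hD : ((2 ^ n : ℂ) ^ 2 - 1) ≠ 0 := by
    have h2 : (1 : ℕ) < (2 ^ n) ^ 2 := Nat.one_lt_pow (by norm_num) (Nat.one_lt_pow (by omega) (by norm_num))
    rw [sub_ne_zero]
    exact_mod_cast h2.ne'
  have key := design_avg G hGone hGunitary hdesign1 hdesign2
  have main := main_ind G hGunitary _ hD key sV sW hV U hU' A hA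
  have hc : (G.card : ℂ) ≠ 0 := by
    exact_mod_cast Finset.card_ne_zero_of_mem hGone
  set O := Matrix.trace (pauliString sW * (U * pauliString sV * Uᴴ) *
        pauliString sW * (U * pauliString sV * Uᴴ)) with hO
  let r : P0 n × P0 n → ℂ := fun q =>
    Matrix.trace (normPauli q.1.1 * ρ) * Matrix.trace (normPauli q.2.1 * ρ)
  have hf : ∀ x y m g1 g2, fA x y m g1 g2 = cov (E x) (E y) ⬝ᵥ (transProd A m g1 g2 *ᵥ r) := by
    intro x y m g1 g2
    have hBv : B x y = Matrix.vecMulVec r (cov (E x) (E y)) := by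
      ext ⟨a, b⟩ ⟨c, d⟩
      rw [hB, Matrix.vecMulVec_apply]
      simp only [r, cov]
      ring
    rw [hfA, hBv, Matrix.mul_assoc, Matrix.vecMulVec_mul, Matrix.trace_vecMulVec,
      Matrix.dotProduct_mulVec, dotProduct_comm]
    rfl
  refine ⟨∑ x : X, ∑ y : X, (((2 ^ n : ℂ) ^ 2 - 1)⁻¹ ^ 2 * ∑ c : P0 n, ∑ d : P0 n, r (c, d) *
        (Matrix.trace (normPauli c.1 * (U * ρ * Uᴴ)) *
          Matrix.trace (normPauli d.1 * (U * ρ * Uᴴ)))) *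
        (qf (E x) (E x) * qf (E y) (E y)), fun m => ?_⟩
  have hs : ∑ g1 : Fin (m + 1) → {g // g ∈ G}, ∑ g2 : Fin (m + 1) → {g // g ∈ G},
          ∑ x : X, ∑ y : X, fA x y m g1 g2 * p x (m + 1) g1 * p y (m + 1) g2
      = ∑ x : X, ∑ y : X, ∑ g1 : Fin (m + 1) → {g // g ∈ G}, ∑ g2 : Fin (m + 1) → {g // g ∈ G},
          fA x y m g1 g2 * p x (m + 1) g1 * p y (m + 1) g2 := by
    have h1 : ∀ g1 : Fin (m + 1) → {g // g ∈ G}, ∑ g2 : Fin (m + 1) → {g // g ∈ G},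
          ∑ x : X, ∑ y : X, fA x y m g1 g2 * p x (m + 1) g1 * p y (m + 1) g2
        = ∑ x : X, ∑ y : X, ∑ g2 : Fin (m + 1) → {g // g ∈ G},
          fA x y m g1 g2 * p x (m + 1) g1 * p y (m + 1) g2 := by
      intro g1
      rw [Finset.sum_comm]
      refine Finset.sum_congr rfl fun x _ => ?_
      rw [Finset.sum_comm]
    simp only [h1]
    rw [Finset.sum_comm]
    refine Finset.sum_congr rfl fun x _ => ?_
    rw [Finset.sum_comm]
  rw [hkA, hs, Finset.mul_sum, Finset.sum_mul]
  refine Finset.sum_congr rfl fun x _ => ?_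
  rw [Finset.mul_sum, Finset.sum_mul]
  refine Finset.sum_congr rfl fun y _ => ?_
  have hm := main (E x) (E y) m r ρ ρ
  have hL : ∑ g1 : Fin (m + 1) → {g // g ∈ G}, ∑ g2 : Fin (m + 1) → {g // g ∈ G},
      fA x y m g1 g2 * p x (m + 1) g1 * p y (m + 1) g2
      = ∑ g1 : Fin (m + 1) → {g // g ∈ G}, ∑ g2 : Fin (m + 1) → {g // g ∈ G},
      (cov (E x) (E y) ⬝ᵥ (transProd A m g1 g2 *ᵥ r)) * Matrix.trace (E x * evol U ρ (m + 1) g1) *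
        Matrix.trace (E y * evol U ρ (m + 1) g2) := by
    refine Finset.sum_congr rfl fun g1 _ => Finset.sum_congr rfl fun g2 _ => ?_
    rw [hf, hp, hp]
    rfl
  rw [hL, hm, mul_assoc ((G.card : ℂ) ^ (2 * (m + 1))), mul_assoc ((G.card : ℂ) ^ (2 * (m + 1))),
    inv_mul_cancel_left₀ (pow_ne_zero _ hc)]

end
end
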